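/- arXiv:2505.08045 — 2 statements merged into one kernel-verified Lean document; each statement's English description precedes it below -/
import Mathlib

section
/- Let m, n ≥ 2 and let D be an m×n grid copula matrix with associated Bernstein copula C_B^D. Define the m×m matrix Ω by: Ω_{i,r} = [C(m,i)C(m,r)/((2m−3)C(2m−4,i+r−2))]·[ir − 2m(m−1)C(i+r,2)/((2m−1)(2m−2))] if 1≤i,r<m; Ω_{i,m} = m(m−1)(i−m)C(m,i)/((2m−1)(2m−2)C(2m−3,m+i−2)) if 1≤i<m; Ω_{m,r} = m(m−1)(r−m)C(m,r)/((2m−1)(2m−2)C(2m−3,m+r−2)) if 1≤r<m; and Ω_{m,m} = m²/(2m−1). Define the n×n matrix Λ by Λ_{j,s} = C(n,j)C(n,s)/((2n+1)C(2n,j+s)) for 1≤j,s≤n. Then ∫_{[0,1]²} (∂₁C_B^D(u,v))² du dv = tr(Ω D Λ Dᵀ), and consequently Chatterjee's xi ξ(C_B^D) = 6∫_{[0,1]²}(∂₁C_B^D)² dλ² − 2 equals 6·tr(Ω D Λ Dᵀ) − 2. -/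
open MeasureTheory

/-- The Bernstein basis polynomial `B_{i,m}(u) = C(m,i) u^i (1-u)^(m-i)`. -/
noncomputable def bern (m i : ℕ) (u : ℝ) : ℝ :=
  (m.choose i : ℝ) * u ^ i * (1 - u) ^ (m - i)

/-- A bivariate copula: grounded, uniform marginals and 2-increasing. -/
def IsCopula (C : ℝ → ℝ → ℝ) : Prop :=
  (∀ u ∈ Set.Icc (0:ℝ) 1, C u 0 = 0 ∧ C 0 u = 0 ∧ C u 1 = u ∧ C 1 u = u) ∧
  (∀ u₁ v₁ u₂ v₂ : ℝ, 0 ≤ u₁ → u₁ ≤ v₁ → v₁ ≤ 1 → 0 ≤ u₂ → u₂ ≤ v₂ → v₂ ≤ 1 →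
    0 ≤ C v₁ v₂ - C u₁ v₂ - C v₁ u₂ + C u₁ u₂)

/-- `D` is a grid copula matrix: `D_{i,j} = C(i/m, j/n)` for some bivariate copula `C`. -/
def IsGridCopulaMatrix (m n : ℕ) (D : Matrix (Fin m) (Fin n) ℝ) : Prop :=
  ∃ C : ℝ → ℝ → ℝ, IsCopula C ∧
    ∀ i j, D i j = C (((i.1 : ℝ) + 1) / m) (((j.1 : ℝ) + 1) / n)

/-- The Bernstein copula associated with the matrix `D`. -/
noncomputable def bernCop (m n : ℕ) (D : Matrix (Fin m) (Fin n) ℝ) (u v : ℝ) : ℝ :=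
  ∑ i : Fin m, ∑ j : Fin n, D i j * bern m (i.1 + 1) u * bern n (j.1 + 1) v

/-- The m×m matrix `Ω` (1-based indices `i' = i+1`, `r' = r+1`):
`Ω_{i,r} = [C(m,i)C(m,r)/((2m−3)C(2m−4,i+r−2))]·[ir − 2m(m−1)C(i+r,2)/((2m−1)(2m−2))]`
for `i,r < m`; boundary cases as in the paper. -/
noncomputable def omegaMat (m : ℕ) : Matrix (Fin m) (Fin m) ℝ := fun i r =>
  if i.1 + 1 < m ∧ r.1 + 1 < m then
    ((m.choose (i.1 + 1) : ℝ) * (m.choose (r.1 + 1) : ℝ) /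
        ((2 * (m : ℝ) - 3) * ((2 * m - 4).choose (i.1 + 1 + (r.1 + 1) - 2) : ℝ))) *
      (((i.1 : ℝ) + 1) * ((r.1 : ℝ) + 1) -
        2 * (m : ℝ) * ((m : ℝ) - 1) * (((i.1 + 1 + (r.1 + 1)).choose 2 : ℕ) : ℝ) /
          ((2 * (m : ℝ) - 1) * (2 * (m : ℝ) - 2)))
  else if i.1 + 1 < m then
    (m : ℝ) * ((m : ℝ) - 1) * (((i.1 : ℝ) + 1) - (m : ℝ)) * (m.choose (i.1 + 1) : ℝ) /
      ((2 * (m : ℝ) - 1) * (2 * (m : ℝ) - 2) * ((2 * m - 3).choose (m + (i.1 + 1) - 2) : ℝ))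
  else if r.1 + 1 < m then
    (m : ℝ) * ((m : ℝ) - 1) * (((r.1 : ℝ) + 1) - (m : ℝ)) * (m.choose (r.1 + 1) : ℝ) /
      ((2 * (m : ℝ) - 1) * (2 * (m : ℝ) - 2) * ((2 * m - 3).choose (m + (r.1 + 1) - 2) : ℝ))
  else (m : ℝ) ^ 2 / (2 * (m : ℝ) - 1)

/-- The n×n matrix `Λ` with `Λ_{j,s} = C(n,j)C(n,s)/((2n+1)C(2n,j+s))` (1-based). -/
noncomputable def lambdaMat (n : ℕ) : Matrix (Fin n) (Fin n) ℝ := fun j s =>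
  (n.choose (j.1 + 1) : ℝ) * (n.choose (s.1 + 1) : ℝ) /
    ((2 * (n : ℝ) + 1) * ((2 * n).choose (j.1 + 1 + (s.1 + 1)) : ℝ))

/-- The derivative of the Bernstein basis polynomial `B_{k+1,m}`. -/
noncomputable def bernDeriv (m k : ℕ) (u : ℝ) : ℝ :=
  (m.choose (k + 1) : ℝ) * ((k + 1) * u ^ k * (1 - u) ^ (m - (k + 1)) -
    ((m - (k + 1) : ℕ) : ℝ) * u ^ (k + 1) * (1 - u) ^ (m - (k + 1) - 1))

theorem hasDerivAt_bern (m k : ℕ) (u : ℝ) :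
    HasDerivAt (bern m (k + 1)) (bernDeriv m k u) u := by
  have h := (((hasDerivAt_id' u).fun_pow (k + 1)).const_mul (m.choose (k + 1) : ℝ)).fun_mul
    (((hasDerivAt_id' u).const_sub 1).fun_pow (m - (k + 1)))
  refine h.congr_deriv ?_
  simp [bernDeriv]
  ring

theorem continuous_bern (m k : ℕ) : Continuous (bern m k) := by
  unfold bern
  fun_prop

theorem continuous_bernDeriv (m k : ℕ) : Continuous (bernDeriv m k) := by
  unfold bernDeriv
  fun_prop

theorem bernDeriv_of_lt (k p : ℕ) (u : ℝ) :
    bernDeriv (k + 2 + p) k u =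
      ((k + 2 + p).choose (k + 1) : ℝ) *
        (u ^ k * (1 - u) ^ p * ((k + 1) - ((k + 2 + p : ℕ) : ℝ) * u)) := by
  have h : k + 2 + p - (k + 1) = p + 1 := by omega
  rw [bernDeriv, h]
  push_cast
  ring

theorem bernDeriv_last (k : ℕ) (u : ℝ) : bernDeriv (k + 1) k u = (k + 1) * u ^ k := by
  simp [bernDeriv]

theorem integral_pow_mul_one_sub_pow_succ (a b : ℕ) :
    ((a : ℝ) + 1) * ∫ u in (0:ℝ)..1, u ^ a * (1 - u) ^ (b + 1) =
      ((b : ℝ) + 1) * ∫ u in (0:ℝ)..1, u ^ (a + 1) * (1 - u) ^ b := by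
  have hd : ∀ u : ℝ, HasDerivAt (fun x : ℝ => x ^ (a + 1) * (1 - x) ^ (b + 1))
      (((a : ℝ) + 1) * (u ^ a * (1 - u) ^ (b + 1)) -
        ((b : ℝ) + 1) * (u ^ (a + 1) * (1 - u) ^ b)) u := by
    intro u
    have h := ((hasDerivAt_id' u).fun_pow (a + 1)).fun_mul
      (((hasDerivAt_id' u).const_sub 1).fun_pow (b + 1))
    refine h.congr_deriv ?_
    simp
    ring
  have h := intervalIntegral.integral_eq_sub_of_hasDerivAt (a := 0) (b := 1)
    (fun u _ => hd u) (Continuous.intervalIntegrable (by fun_prop) _ _)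
  rw [intervalIntegral.integral_sub (Continuous.intervalIntegrable (by fun_prop) _ _)
    (Continuous.intervalIntegrable (by fun_prop) _ _), intervalIntegral.integral_const_mul,
    intervalIntegral.integral_const_mul] at h
  simp at h
  linarith

theorem integral_pow_mul_one_sub_pow_factorial (a b : ℕ) :
    ∫ u in (0:ℝ)..1, u ^ a * (1 - u) ^ b =
      (a.factorial * b.factorial : ℝ) / ((a + b + 1).factorial : ℝ) := by
  induction b generalizing a with
  | zero =>
    have := a.factorial_pos
    simp [Nat.factorial_succ]
    field_simp
  | succ b ih =>
    have h := integral_pow_mul_one_sub_pow_succ a b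
    rw [ih] at h
    have ha : (a : ℝ) + 1 ≠ 0 := by positivity
    apply mul_left_cancel₀ ha
    rw [h, show a + 1 + b + 1 = a + (b + 1) + 1 by ring]
    simp only [Nat.factorial_succ a, Nat.factorial_succ b]
    push_cast
    ring

theorem integral_pow_mul_one_sub_pow (a b : ℕ) :
    ∫ u in (0:ℝ)..1, u ^ a * (1 - u) ^ b =
      1 / (((a + b : ℕ) + 1 : ℝ) * ((a + b).choose a : ℝ)) := by
  rw [integral_pow_mul_one_sub_pow_factorial, Nat.choose_symm_add, Nat.add_choose,
    Nat.cast_div (Nat.factorial_mul_factorial_dvd_factorial_add a b) (by positivity),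
    Nat.factorial_succ]
  push_cast
  field_simp

theorem integral_pow_succ_mul_one_sub_pow (a b : ℕ) :
    ∫ u in (0:ℝ)..1, u ^ (a + 1) * (1 - u) ^ b =
      (a + 1) / (a + b + 2) * ∫ u in (0:ℝ)..1, u ^ a * (1 - u) ^ b := by
  simp only [integral_pow_mul_one_sub_pow_factorial]
  rw [show a + 1 + b + 1 = (a + b + 1) + 1 by ring, Nat.factorial_succ a,
    Nat.factorial_succ (a + b + 1)]
  push_cast
  field_simp
  ring

theorem integral_pow_mul_one_sub_pow_mul_linear (a b : ℕ) (x c : ℝ) :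
    ∫ u in (0:ℝ)..1, u ^ a * (1 - u) ^ b * (x - c * u) =
      (x - c * ((a + 1) / (a + b + 2))) * ∫ u in (0:ℝ)..1, u ^ a * (1 - u) ^ b := by
  have h : ∀ u : ℝ, u ^ a * (1 - u) ^ b * (x - c * u) =
      x * (u ^ a * (1 - u) ^ b) - c * (u ^ (a + 1) * (1 - u) ^ b) := fun u => by ring
  simp only [h]
  rw [intervalIntegral.integral_sub (Continuous.intervalIntegrable (by fun_prop) _ _)
    (Continuous.intervalIntegrable (by fun_prop) _ _), intervalIntegral.integral_const_mul,
    intervalIntegral.integral_const_mul, integral_pow_succ_mul_one_sub_pow]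
  ring

theorem integral_pow_mul_one_sub_pow_mul_quadratic (a b : ℕ) (x y c : ℝ) :
    ∫ u in (0:ℝ)..1, u ^ a * (1 - u) ^ b * ((x - c * u) * (y - c * u)) =
      (x * y - c * (x + y) * ((a + 1) / (a + b + 2)) +
        c ^ 2 * ((a + 1) / (a + b + 2) * ((a + 2) / (a + b + 3)))) *
        ∫ u in (0:ℝ)..1, u ^ a * (1 - u) ^ b := by
  have h : ∀ u : ℝ, u ^ a * (1 - u) ^ b * ((x - c * u) * (y - c * u)) =
      x * (u ^ a * (1 - u) ^ b * (y - c * u)) -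
        c * (u ^ (a + 1) * (1 - u) ^ b * (y - c * u)) := fun u => by ring
  simp only [h]
  rw [intervalIntegral.integral_sub (Continuous.intervalIntegrable (by fun_prop) _ _)
    (Continuous.intervalIntegrable (by fun_prop) _ _), intervalIntegral.integral_const_mul,
    intervalIntegral.integral_const_mul, integral_pow_mul_one_sub_pow_mul_linear,
    integral_pow_mul_one_sub_pow_mul_linear, integral_pow_succ_mul_one_sub_pow]
  push_cast
  rw [show (a : ℝ) + 1 + b + 2 = a + b + 3 by ring, show (a : ℝ) + 1 + 1 = a + 2 by ring]
  ring

theorem integral_bern_mul_bern (n : ℕ) (j s : Fin n) :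
    ∫ v in (0:ℝ)..1, bern n (j.1 + 1) v * bern n (s.1 + 1) v = lambdaMat n j s := by
  have h : ∀ v : ℝ, bern n (j.1 + 1) v * bern n (s.1 + 1) v =
      ((n.choose (j.1 + 1) : ℝ) * (n.choose (s.1 + 1) : ℝ)) *
        (v ^ (j.1 + 1 + (s.1 + 1)) * (1 - v) ^ (n - (j.1 + 1) + (n - (s.1 + 1)))) := by
    intro v
    rw [bern, bern, pow_add, pow_add]
    ring
  simp only [h]
  rw [intervalIntegral.integral_const_mul, integral_pow_mul_one_sub_pow,
    show j.1 + 1 + (s.1 + 1) + (n - (j.1 + 1) + (n - (s.1 + 1))) = 2 * n by omega, lambdaMat]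
  push_cast
  ring

theorem integral_bernDeriv_mul_last (k p : ℕ) :
    ∫ u in (0:ℝ)..1, bernDeriv (k + 2 + p) k u * bernDeriv (k + 2 + p) (k + 1 + p) u =
      ((k + 2 + p : ℕ) : ℝ) * (((k + 2 + p : ℕ) : ℝ) - 1) * (((k : ℝ) + 1) - (k + 2 + p : ℕ)) *
        ((k + 2 + p).choose (k + 1) : ℝ) /
      ((2 * ((k + 2 + p : ℕ) : ℝ) - 1) * (2 * ((k + 2 + p : ℕ) : ℝ) - 2) *
        ((2 * (k + 2 + p) - 3).choose ((k + 2 + p) + (k + 1) - 2) : ℝ)) := by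
  have h : ∀ u : ℝ, bernDeriv (k + 2 + p) k u * bernDeriv (k + 2 + p) (k + 1 + p) u =
      (((k + 2 + p).choose (k + 1) : ℝ) * ((k + 2 + p : ℕ) : ℝ)) *
        (u ^ (k + (k + 1 + p)) * (1 - u) ^ p * ((k + 1) - ((k + 2 + p : ℕ) : ℝ) * u)) := by
    intro u
    have hl := bernDeriv_last (k + 1 + p) u
    rw [show k + 1 + p + 1 = k + 2 + p by ring] at hl
    rw [bernDeriv_of_lt, hl, pow_add u k]
    push_cast
    ring
  simp only [h]
  rw [intervalIntegral.integral_const_mul, integral_pow_mul_one_sub_pow_mul_linear,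
    integral_pow_mul_one_sub_pow,
    show k + (k + 1 + p) + p = 2 * (k + 2 + p) - 3 by omega,
    show k + 2 + p + (k + 1) - 2 = k + (k + 1 + p) by omega]
  have hc : ((2 * (k + 2 + p) - 3).choose (k + (k + 1 + p)) : ℝ) ≠ 0 := by
    exact_mod_cast (Nat.choose_pos (by omega)).ne'
  have e : ((2 * (k + 2 + p) - 3 : ℕ) : ℝ) + 1 = 2 * (k + p + 1) := by
    rw [show 2 * (k + 2 + p) - 3 = 2 * k + 2 * p + 1 by omega]
    push_cast
    ring
  rw [e]
  generalize ((2 * (k + 2 + p) - 3).choose (k + (k + 1 + p)) : ℝ) = C₁ at hc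
  push_cast
  rw [show (k : ℝ) + (k + 1 + p) + p + 2 = 2 * k + 2 * p + 3 by ring,
    show 2 * ((k : ℝ) + 2 + p) - 1 = 2 * k + 2 * p + 3 by ring,
    show 2 * ((k : ℝ) + 2 + p) - 2 = 2 * (k + p + 1) by ring]
  field_simp
  ring

theorem integral_bernDeriv_mul_of_lt {m i r : ℕ} (hi : i + 1 < m) (hr : r + 1 < m) :
    ∫ u in (0:ℝ)..1, bernDeriv m i u * bernDeriv m r u =
    ((m.choose (i + 1) : ℝ) * (m.choose (r + 1) : ℝ) /
        ((2 * (m : ℝ) - 3) * ((2 * m - 4).choose (i + 1 + (r + 1) - 2) : ℝ))) *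
      (((i : ℝ) + 1) * ((r : ℝ) + 1) -
        2 * (m : ℝ) * ((m : ℝ) - 1) * (((i + 1 + (r + 1)).choose 2 : ℕ) : ℝ) /
          ((2 * (m : ℝ) - 1) * (2 * (m : ℝ) - 2))) := by
  obtain ⟨p, hp⟩ : ∃ p, m = i + 2 + p := ⟨m - (i + 2), by omega⟩
  obtain ⟨q, hq⟩ : ∃ q, m = r + 2 + q := ⟨m - (r + 2), by omega⟩
  have h : ∀ u : ℝ, bernDeriv m i u * bernDeriv m r u =
      ((m.choose (i + 1) : ℝ) * (m.choose (r + 1) : ℝ)) *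
        (u ^ (i + r) * (1 - u) ^ (p + q) *
          (((i + 1 : ℝ) - (m : ℝ) * u) * ((r + 1 : ℝ) - (m : ℝ) * u))) := by
    intro u
    have h₁ := bernDeriv_of_lt i p u
    have h₂ := bernDeriv_of_lt r q u
    rw [← hp] at h₁
    rw [← hq] at h₂
    rw [h₁, h₂, pow_add, pow_add]
    ring
  simp only [h]
  rw [intervalIntegral.integral_const_mul, integral_pow_mul_one_sub_pow_mul_quadratic,
    integral_pow_mul_one_sub_pow, show i + r + (p + q) = 2 * m - 4 by omega,
    show i + 1 + (r + 1) - 2 = i + r by omega, Nat.cast_choose_two]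
  have e : ((2 * m - 4 : ℕ) : ℝ) = 2 * m - 4 := by
    rw [Nat.cast_sub (by omega)]
    push_cast
    ring
  have e' : ((i + r : ℕ) : ℝ) + ((p + q : ℕ) : ℝ) = 2 * m - 4 := by
    rw [← e]
    exact_mod_cast (by omega : i + r + (p + q) = 2 * m - 4)
  have hc : ((2 * m - 4).choose (i + r) : ℝ) ≠ 0 := by
    exact_mod_cast (Nat.choose_pos (by omega)).ne'
  have hm : (2 : ℝ) ≤ m := by exact_mod_cast (by omega : 2 ≤ m)
  rw [e, e']
  generalize ((2 * m - 4).choose (i + r) : ℝ) = C₁ at hc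
  push_cast
  have h₁ : (m * 2 - 1 : ℝ) ≠ 0 := by linarith
  have h₂ : (m - 1 : ℝ) ≠ 0 := by linarith
  have h₃ : (m * 2 - 3 : ℝ) ≠ 0 := by linarith
  rw [show (2 * m - 4 + 2 : ℝ) = 2 * m - 2 by ring, show (2 * m - 4 + 3 : ℝ) = 2 * m - 1 by ring,
    show (2 * m - 4 + 1 : ℝ) = 2 * m - 3 by ring,
    show (2 * m - 2 : ℝ) = 2 * (m - 1) by ring]
  field_simp
  ring

theorem integral_bernDeriv_mul_bernDeriv {m : ℕ} (i r : Fin m) :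
    ∫ u in (0:ℝ)..1, bernDeriv m i u * bernDeriv m r u = omegaMat m i r := by
  obtain ⟨i, hi⟩ := i
  obtain ⟨r, hr⟩ := r
  unfold omegaMat
  dsimp only
  split_ifs with h₁ h₂ h₃
  · exact integral_bernDeriv_mul_of_lt h₁.1 h₁.2
  · obtain ⟨p, rfl⟩ : ∃ p, m = i + 2 + p := ⟨m - (i + 2), by omega⟩
    obtain rfl : r = i + 1 + p := by omega
    exact integral_bernDeriv_mul_last i p
  · obtain ⟨p, rfl⟩ : ∃ p, m = r + 2 + p := ⟨m - (r + 2), by omega⟩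
    obtain rfl : i = r + 1 + p := by omega
    simp only [mul_comm (bernDeriv _ (r + 1 + p) _)]
    exact integral_bernDeriv_mul_last r p
  · obtain rfl : m = i + 1 := by omega
    obtain rfl : r = i := by omega
    have h : ∀ u : ℝ, bernDeriv (r + 1) r u * bernDeriv (r + 1) r u =
        ((r : ℝ) + 1) ^ 2 * u ^ (2 * r) := by
      intro u
      rw [bernDeriv_last]
      ring
    simp only [h]
    rw [intervalIntegral.integral_const_mul, integral_pow]
    push_cast
    rw [show 2 * ((r : ℝ) + 1) - 1 = 2 * r + 1 by ring]
    simp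
    ring

theorem integral_sum_mul_sum {ι : Type*} [Fintype ι] (c d : ι → ℝ) (g : ι → ℝ → ℝ)
    (hg : ∀ i, Continuous (g i)) (a b : ℝ) :
    ∫ x in a..b, (∑ i, c i * g i x) * (∑ i, d i * g i x) =
      ∑ i, ∑ j, c i * d j * ∫ x in a..b, g i x * g j x := by
  simp only [Finset.sum_mul_sum]
  rw [intervalIntegral.integral_finsetSum
    fun i _ => Continuous.intervalIntegrable (by fun_prop) _ _]
  refine Finset.sum_congr rfl fun i _ => ?_
  rw [intervalIntegral.integral_finsetSum
    fun j _ => Continuous.intervalIntegrable (by fun_prop) _ _]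
  refine Finset.sum_congr rfl fun j _ => ?_
  rw [← intervalIntegral.integral_const_mul]
  congr 1
  ext x
  ring

theorem deriv_bernCop (m n : ℕ) (D : Matrix (Fin m) (Fin n) ℝ) (u v : ℝ) :
    deriv (fun x => bernCop m n D x v) u =
      ∑ j : Fin n, (∑ i : Fin m, D i j * bernDeriv m i u) * bern n (j + 1) v := by
  have h : HasDerivAt (fun x => bernCop m n D x v)
      (∑ i : Fin m, ∑ j : Fin n, D i j * bernDeriv m i u * bern n (j + 1) v) u := by
    unfold bernCop
    exact HasDerivAt.fun_sum fun i _ => HasDerivAt.fun_sum fun j _ =>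
      ((hasDerivAt_bern m i u).const_mul (D i j)).mul_const _
  rw [h.deriv, Finset.sum_comm]
  simp only [Finset.sum_mul]

theorem integral_sq_deriv_bernCop (m n : ℕ) (D : Matrix (Fin m) (Fin n) ℝ) :
    ∫ u in (0:ℝ)..1, ∫ v in (0:ℝ)..1, (deriv (fun x => bernCop m n D x v) u) ^ 2 =
      Matrix.trace (omegaMat m * D * lambdaMat n * D.transpose) := by
  have hbern := continuous_bernDeriv m
  simp only [deriv_bernCop, sq]
  simp_rw [integral_sum_mul_sum _ _ (fun (j : Fin n) v => bern n (j + 1) v)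
    (fun j => continuous_bern n _), integral_bern_mul_bern]
  rw [intervalIntegral.integral_finsetSum
    fun j _ => Continuous.intervalIntegrable (by fun_prop) _ _]
  have h : ∀ j s : Fin n,
      ∫ u in (0:ℝ)..1, (∑ i : Fin m, D i j * bernDeriv m i u) *
          (∑ i : Fin m, D i s * bernDeriv m i u) * lambdaMat n j s =
        ∑ i, ∑ r, D i j * D r s * omegaMat m i r * lambdaMat n j s := by
    intro j s
    rw [intervalIntegral.integral_mul_const,
      integral_sum_mul_sum _ _ (fun (i : Fin m) u => bernDeriv m i u) (fun i => hbern i)]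
    simp only [integral_bernDeriv_mul_bernDeriv, Finset.sum_mul]
  have h' : ∀ j : Fin n,
      ∫ u in (0:ℝ)..1, ∑ s, (∑ i : Fin m, D i j * bernDeriv m i u) *
          (∑ i : Fin m, D i s * bernDeriv m i u) * lambdaMat n j s =
        ∑ s, ∑ i, ∑ r, D i j * D r s * omegaMat m i r * lambdaMat n j s := by
    intro j
    rw [intervalIntegral.integral_finsetSum
      fun s _ => Continuous.intervalIntegrable (by fun_prop) _ _]
    simp only [h]
  simp only [h']
  simp only [Matrix.trace, Matrix.diag, Matrix.mul_apply, Matrix.transpose_apply,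
    Finset.sum_mul]
  rw [Finset.sum_congr rfl fun j _ => Finset.sum_comm, Finset.sum_comm]
  refine Finset.sum_congr rfl fun i _ => Finset.sum_congr rfl fun j _ =>
    Finset.sum_congr rfl fun s _ => Finset.sum_congr rfl fun r _ => ?_
  rw [← integral_bern_mul_bern n j s, ← integral_bern_mul_bern n s j]
  simp only [mul_comm (bern n (j + 1) _)]
  ring

/-- for a grid copula matrix `D` (m, n ≥ 2),
`∫_{[0,1]²} (∂₁C_B^D)² = tr(Ω D Λ Dᵀ)`, and consequently Chatterjee's xi
`ξ(C_B^D) = 6∫(∂₁C_B^D)² − 2` equals `6 tr(Ω D Λ Dᵀ) − 2`. -/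
theorem bernstein_chatterjee_xi (m n : ℕ) (hm : 2 ≤ m) (hn : 2 ≤ n)
    (D : Matrix (Fin m) (Fin n) ℝ) (hD : IsGridCopulaMatrix m n D) :
    (∫ u in (0:ℝ)..1, ∫ v in (0:ℝ)..1,
        (deriv (fun x => bernCop m n D x v) u) ^ 2)
      = Matrix.trace (omegaMat m * D * lambdaMat n * D.transpose) ∧
    6 * (∫ u in (0:ℝ)..1, ∫ v in (0:ℝ)..1,
        (deriv (fun x => bernCop m n D x v) u) ^ 2) - 2
      = 6 * Matrix.trace (omegaMat m * D * lambdaMat n * D.transpose) - 2 := by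
  have h := integral_sq_deriv_bernCop m n D
  exact ⟨h, by rw [h]⟩
end

section
/- Let m, n ≥ 1 and let Δ be an m×n checkerboard matrix. Define p : [0,1)² → ℝ by p(u,v) = m·( ∑_{l=1}^{j−1} Δ_{i,l} + Δ_{i,j}(nv−j+1) ) for (u,v) ∈ I_{i,j} (this is the a.e. partial derivative ∂₁C_Π^Δ of the checkerboard copula). Then ∫_{[0,1]²} p(u,v)² du dv = (m/n) ∑_{i=1}^{m} ∑_{j=1}^{n} [ ( ∑_{l=1}^{j−1} Δ_{i,l} )² + ( ∑_{l=1}^{j−1} Δ_{i,l} )·Δ_{i,j} + (1/3)·Δ_{i,j}² ]. Consequently, Chatterjee's xi ξ(C_Π^Δ) = 6∫_{[0,1]²} p² dλ² − 2 equals (6m/n)·tr( Δᵀ Δ (T Tᵀ + Tᵀ + (1/3)I_n) ) − 2, where T is the strict upper-triangular n×n matrix with T_{i,j} = 1 if i<j and 0 otherwise. -/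
open MeasureTheory Finset

/-- `Δ` is an m×n checkerboard matrix: nonnegative entries, column sums `1/n`,
row sums `1/m`. -/
def IsCheckerboard (m n : ℕ) (Δ : Matrix (Fin m) (Fin n) ℝ) : Prop :=
  (∀ i j, 0 ≤ Δ i j) ∧ (∀ j, ∑ i, Δ i j = 1 / n) ∧ (∀ i, ∑ j, Δ i j = 1 / m)

/-- Entry access with natural-number (0-based) indices, `0` out of range. -/
noncomputable def cbEntry (m n : ℕ) (Δ : Matrix (Fin m) (Fin n) ℝ) (k l : ℕ) : ℝ :=
  if h : k < m ∧ l < n then Δ ⟨k, h.1⟩ ⟨l, h.2⟩ else 0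

/-- The (0-based) cell index of `u`: `⌊mu⌋`, clamped to `m−1` (so that `u = 1`
belongs to the last cell, realizing the extension with `i = m`). -/
noncomputable def cbIdx (m : ℕ) (u : ℝ) : ℕ := min ⌊(m : ℝ) * u⌋₊ (m - 1)

/-- The a.e. partial derivative `∂₁C_Π^Δ` of the checkerboard copula:
`p(u,v) = m(∑_{l<j} Δᵢₗ + Δᵢⱼ(nv−j+1))` on cell `Iᵢⱼ`. -/
noncomputable def pPi (m n : ℕ) (Δ : Matrix (Fin m) (Fin n) ℝ) (u v : ℝ) : ℝ :=
  (m : ℝ) * ((∑ l ∈ Finset.range (cbIdx n v), cbEntry m n Δ (cbIdx m u) l)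
    + cbEntry m n Δ (cbIdx m u) (cbIdx n v) * ((n : ℝ) * v - cbIdx n v))

/-- The strict upper-triangular matrix `T` with `Tᵢⱼ = 1` iff `i < j`. -/
noncomputable def upT (n : ℕ) : Matrix (Fin n) (Fin n) ℝ := fun i j =>
  if i < j then 1 else 0

/-- On the open `k`-th cell, the cell index is `k`. -/
lemma cbIdx_eq_of_mem_Ioo {m k : ℕ} (hk : k < m) {u : ℝ}
    (hu : u ∈ Set.Ioo ((k : ℝ) / m) (((k + 1 : ℕ) : ℝ) / m)) : cbIdx m u = k := by
  have hm : (0 : ℝ) < m := by exact_mod_cast (Nat.zero_le k).trans_lt hk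
  obtain ⟨h1, h2⟩ := hu
  rw [div_lt_iff₀ hm] at h1
  rw [lt_div_iff₀ hm] at h2
  push_cast at h2
  have hf : ⌊(m : ℝ) * u⌋₊ = k := by
    rw [Nat.floor_eq_iff (by nlinarith [(Nat.cast_nonneg k : (0 : ℝ) ≤ k)])]
    constructor <;> linarith
  rw [cbIdx, hf]
  omega

/-- A function given by a continuous formula on each cell integrates cell by cell. -/
lemma integral_eq_sum_cells {m : ℕ} (hm : 1 ≤ m) (g : ℕ → ℝ → ℝ) (hg : ∀ k, Continuous (g k)) :
    ∫ u in (0 : ℝ)..1, g (cbIdx m u) u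
      = ∑ k ∈ Finset.range m, ∫ u in ((k : ℝ) / m)..(((k + 1 : ℕ) : ℝ) / m), g k u := by
  have hm0 : (0 : ℝ) < m := by exact_mod_cast hm
  have hle : ∀ k : ℕ, (k : ℝ) / m ≤ ((k + 1 : ℕ) : ℝ) / m := fun k => by
    gcongr
    exact Nat.le_succ k
  have heq : ∀ k < m, Set.EqOn (g k) (fun u => g (cbIdx m u) u)
      (Set.Ioo ((k : ℝ) / m) (((k + 1 : ℕ) : ℝ) / m)) := fun k hk u hu => by
    simp only [cbIdx_eq_of_mem_Ioo hk hu]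
  have hint : ∀ k < m, IntervalIntegrable (fun u => g (cbIdx m u) u) volume
      ((k : ℝ) / m) (((k + 1 : ℕ) : ℝ) / m) := fun k hk => by
    have h := (hg k).intervalIntegrable (μ := volume) ((k : ℝ) / m) (((k + 1 : ℕ) : ℝ) / m)
    rw [intervalIntegrable_iff_integrableOn_Ioo_of_le (hle k)] at h ⊢
    exact h.congr_fun (heq k hk) measurableSet_Ioo
  have hsum := intervalIntegral.sum_integral_adjacent_intervals
    (a := fun k : ℕ => (k : ℝ) / m) hint
  simp only [Nat.cast_zero, zero_div, div_self hm0.ne'] at hsum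
  rw [← hsum]
  refine Finset.sum_congr rfl fun k hk => ?_
  rw [intervalIntegral.integral_of_le (hle k), intervalIntegral.integral_of_le (hle k),
    integral_Ioc_eq_integral_Ioo, integral_Ioc_eq_integral_Ioo]
  exact (setIntegral_congr_fun measurableSet_Ioo (heq k (Finset.mem_range.mp hk))).symm

lemma integral_affine_sq_unit (s d : ℝ) :
    ∫ x in (0 : ℝ)..1, (s + d * x) ^ 2 = s ^ 2 + s * d + (1 / 3) * d ^ 2 := by
  have h : ∀ x ∈ Set.uIcc (0 : ℝ) 1,
      HasDerivAt (fun x => s ^ 2 * x + s * d * x ^ 2 + d ^ 2 / 3 * x ^ 3) ((s + d * x) ^ 2) x := by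
    intro x _
    have h1 := (((hasDerivAt_id x).const_mul (s ^ 2)).add
      ((hasDerivAt_pow 2 x).const_mul (s * d))).add ((hasDerivAt_pow 3 x).const_mul (d ^ 2 / 3))
    refine h1.congr_deriv ?_
    push_cast
    ring
  rw [intervalIntegral.integral_eq_sub_of_hasDerivAt h
    ((by fun_prop : Continuous fun x : ℝ => (s + d * x) ^ 2).intervalIntegrable _ _)]
  ring

/-- The integral of the square of an affine interpolation over the `j`-th cell. -/
lemma integral_affine_sq_cell {n : ℕ} (hn : 1 ≤ n) (c s d : ℝ) (j : ℕ) :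
    ∫ v in ((j : ℝ) / n)..(((j + 1 : ℕ) : ℝ) / n), (c * (s + d * ((n : ℝ) * v - j))) ^ 2
      = c ^ 2 / n * (s ^ 2 + s * d + (1 / 3) * d ^ 2) := by
  have hn0 : (n : ℝ) ≠ 0 := by exact_mod_cast (by omega : n ≠ 0)
  have h := intervalIntegral.integral_comp_mul_sub (a := (j : ℝ) / n)
    (b := ((j + 1 : ℕ) : ℝ) / n) (fun x : ℝ => (s + d * x) ^ 2) hn0 (j : ℝ)
  rw [mul_div_cancel₀ _ hn0, mul_div_cancel₀ _ hn0, sub_self, Nat.cast_succ,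
    add_sub_cancel_left, integral_affine_sq_unit] at h
  simp only [mul_pow, intervalIntegral.integral_const_mul, Nat.cast_succ]
  rw [h, smul_eq_mul]
  ring

lemma cbEntry_fin {m n : ℕ} (Δ : Matrix (Fin m) (Fin n) ℝ) (i : Fin m) (j : Fin n) :
    cbEntry m n Δ i j = Δ i j := by
  simp [cbEntry]

lemma sum_range_cbEntry {m n : ℕ} (Δ : Matrix (Fin m) (Fin n) ℝ) (i : Fin m) (j : Fin n) :
    ∑ l ∈ Finset.range j, cbEntry m n Δ i l = ∑ l ∈ Finset.Iio j, Δ i l := by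
  rw [← Nat.Iio_eq_range, ← Fin.map_valEmbedding_Iio, Finset.sum_map]
  exact Finset.sum_congr rfl fun l _ => cbEntry_fin Δ i l

lemma integral_pPi_sq {m n : ℕ} (hm : 1 ≤ m) (hn : 1 ≤ n) (Δ : Matrix (Fin m) (Fin n) ℝ) :
    (∫ u in (0 : ℝ)..1, ∫ v in (0 : ℝ)..1, (pPi m n Δ u v) ^ 2)
      = ((m : ℝ) / n) * ∑ i : Fin m, ∑ j : Fin n,
          ((∑ l ∈ Finset.Iio j, Δ i l) ^ 2 + (∑ l ∈ Finset.Iio j, Δ i l) * Δ i j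
            + (1 / 3) * (Δ i j) ^ 2) := by
  have hm0 : (m : ℝ) ≠ 0 := by exact_mod_cast (by omega : m ≠ 0)
  have hinner : ∀ u : ℝ, ∫ v in (0 : ℝ)..1, (pPi m n Δ u v) ^ 2
      = ∑ j ∈ Finset.range n, (m : ℝ) ^ 2 / n *
        ((∑ l ∈ Finset.range j, cbEntry m n Δ (cbIdx m u) l) ^ 2
          + (∑ l ∈ Finset.range j, cbEntry m n Δ (cbIdx m u) l) * cbEntry m n Δ (cbIdx m u) j
          + (1 / 3) * cbEntry m n Δ (cbIdx m u) j ^ 2) := fun u => by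
    have h := integral_eq_sum_cells hn (fun j v =>
      ((m : ℝ) * ((∑ l ∈ Finset.range j, cbEntry m n Δ (cbIdx m u) l)
        + cbEntry m n Δ (cbIdx m u) j * ((n : ℝ) * v - j))) ^ 2) (fun j => by fun_prop)
    simp only [integral_affine_sq_cell hn] at h
    exact h
  simp only [hinner]
  rw [integral_eq_sum_cells hm (fun i _ => ∑ j ∈ Finset.range n, (m : ℝ) ^ 2 / n *
        ((∑ l ∈ Finset.range j, cbEntry m n Δ i l) ^ 2
          + (∑ l ∈ Finset.range j, cbEntry m n Δ i l) * cbEntry m n Δ i j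
          + (1 / 3) * cbEntry m n Δ i j ^ 2)) (fun _ => continuous_const)]
  simp only [intervalIntegral.integral_const, smul_eq_mul, Finset.sum_range, Finset.mul_sum]
  refine Finset.sum_congr rfl fun i _ => Finset.sum_congr rfl fun j _ => ?_
  rw [← Finset.sum_range (fun l => cbEntry m n Δ i l), sum_range_cbEntry, cbEntry_fin]
  push_cast
  field_simp
  ring

lemma mul_upT_apply {m n : ℕ} (Δ : Matrix (Fin m) (Fin n) ℝ) (i : Fin m) (j : Fin n) :
    (Δ * upT n) i j = ∑ l ∈ Finset.Iio j, Δ i l := by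
  simp only [Matrix.mul_apply, upT, mul_ite, mul_one, mul_zero, ← Finset.sum_filter]
  congr 1
  ext l
  simp

lemma trace_transpose_mul_eq_sum {m n : ℕ} (A B : Matrix (Fin m) (Fin n) ℝ) :
    (A.transpose * B).trace = ∑ i, ∑ j, A i j * B i j := by
  simp only [Matrix.trace, Matrix.diag_apply, Matrix.mul_apply, Matrix.transpose_apply]
  exact Finset.sum_comm

lemma trace_gram_mul_upT {m n : ℕ} (Δ : Matrix (Fin m) (Fin n) ℝ) :
    Matrix.trace (Δ.transpose * Δ * (upT n * (upT n).transpose + (upT n).transpose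
        + (1 / 3 : ℝ) • (1 : Matrix (Fin n) (Fin n) ℝ)))
      = ∑ i : Fin m, ∑ j : Fin n,
          ((∑ l ∈ Finset.Iio j, Δ i l) ^ 2 + (∑ l ∈ Finset.Iio j, Δ i l) * Δ i j
            + (1 / 3) * (Δ i j) ^ 2) := by
  have h1 : Matrix.trace (Δ.transpose * Δ * (upT n * (upT n).transpose))
      = ((Δ * upT n).transpose * (Δ * upT n)).trace := by
    rw [← Matrix.mul_assoc, Matrix.trace_mul_comm, Matrix.transpose_mul]
    simp only [Matrix.mul_assoc]
  have h2 : Matrix.trace (Δ.transpose * Δ * (upT n).transpose)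
      = ((Δ * upT n).transpose * Δ).trace := by
    rw [Matrix.trace_mul_comm, Matrix.transpose_mul, Matrix.mul_assoc]
  rw [Matrix.mul_add, Matrix.mul_add, Matrix.trace_add, Matrix.trace_add, h1, h2,
    Matrix.mul_smul, Matrix.mul_one, Matrix.trace_smul]
  simp only [trace_transpose_mul_eq_sum, mul_upT_apply, smul_eq_mul, Finset.mul_sum,
    Finset.sum_add_distrib, sq]

/-- `∫_{[0,1]²} p² = (m/n) ∑ᵢⱼ [(∑_{l<j}Δᵢₗ)² + (∑_{l<j}Δᵢₗ)Δᵢⱼ + Δᵢⱼ²/3]`,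
and consequently Chatterjee's xi
`ξ(C_Π^Δ) = 6∫p² − 2 = (6m/n) tr(Δᵀ Δ (TTᵀ + Tᵀ + (1/3)Iₙ)) − 2`. -/
theorem checkerboard_chatterjee_xi (m n : ℕ) (hm : 1 ≤ m) (hn : 1 ≤ n)
    (Δ : Matrix (Fin m) (Fin n) ℝ) (hΔ : IsCheckerboard m n Δ) :
    (∫ u in (0:ℝ)..1, ∫ v in (0:ℝ)..1, (pPi m n Δ u v) ^ 2)
      = ((m : ℝ) / n) * ∑ i : Fin m, ∑ j : Fin n,
          ((∑ l ∈ Finset.Iio j, Δ i l) ^ 2 + (∑ l ∈ Finset.Iio j, Δ i l) * Δ i j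
            + (1 / 3) * (Δ i j) ^ 2) ∧
    6 * (∫ u in (0:ℝ)..1, ∫ v in (0:ℝ)..1, (pPi m n Δ u v) ^ 2) - 2
      = (6 * (m : ℝ) / n) *
          Matrix.trace (Δ.transpose * Δ *
            (upT n * (upT n).transpose + (upT n).transpose
              + (1 / 3 : ℝ) • (1 : Matrix (Fin n) (Fin n) ℝ))) - 2 := by
  refine ⟨integral_pPi_sq hm hn Δ, ?_⟩
  rw [integral_pPi_sq hm hn Δ, trace_gram_mul_upT]
  ring
end
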